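/- Let Ω ⊂ ℝ² be a bounded open set with smooth (C^∞) boundary, let x ∈ Ω, and let G_{Ω,x} be the Green's function of Ω with singularity at x. Then for every t ∈ [0,∞), ∫_{{y ∈ Ω : G_{Ω,x}(y) < t}} |∇G_{Ω,x}(y)|² dy = t. -/

import Mathlib

open MeasureTheory Metric Real
open scoped RealInnerProductSpace

/-- `Ω ⊂ ℝ²` has smooth (`C^∞`) boundary: its topological boundary is a finite
union of images of periodic regular smooth closed curves. -/
def HasSmoothBoundary (Ω : Set (EuclideanSpace ℝ (Fin 2))) : Prop :=
  ∃ (n : ℕ) (γ : Fin n → ℝ → EuclideanSpace ℝ (Fin 2)),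
    (∀ i, ContDiff ℝ (⊤ : ℕ∞) (γ i)) ∧ (∀ i, Function.Periodic (γ i) 1) ∧
    (∀ i t, deriv (γ i) t ≠ 0) ∧ frontier Ω = ⋃ i, Set.range (γ i)

/-- `G` is the Green's function of `Ω` with singularity at `x`: positive on
`Ω \ {x}`, vanishing continuously on `∂Ω`, harmonic on `Ω \ {x}`, and satisfying
the weak formulation `∫_Ω ⟪∇G, ∇f⟫ = f(x)` for all `f ∈ C_c^∞(Ω)`. -/
def IsGreensFunction (Ω : Set (EuclideanSpace ℝ (Fin 2)))
    (x : EuclideanSpace ℝ (Fin 2)) (G : EuclideanSpace ℝ (Fin 2) → ℝ) : Prop :=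
  (∀ y ∈ Ω \ {x}, 0 < G y) ∧
  ContinuousOn G (closure Ω \ {x}) ∧
  (∀ y ∈ frontier Ω, G y = 0) ∧
  ContDiffOn ℝ (⊤ : ℕ∞) G (Ω \ {x}) ∧
  (∀ y ∈ Ω \ {x},
    ∑ i : Fin 2, fderiv ℝ (fun z => fderiv ℝ G z (EuclideanSpace.single i 1)) y
      (EuclideanSpace.single i 1) = 0) ∧
  (∀ f : EuclideanSpace ℝ (Fin 2) → ℝ, ContDiff ℝ (⊤ : ℕ∞) f → HasCompactSupport f →
    tsupport f ⊆ Ω → (∫ y in Ω, ⟪gradient G y, gradient f y⟫) = f x)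

lemma circle_lower (h : ℂ → ℂ) (z : ℂ) (r ρ : ℝ) (hρ : 0 < ρ) (hr : ρ < r)
    (hd : DifferentiableOn ℂ h (ball z r)) :
    ENNReal.ofReal (2*π) * ‖h z‖ₑ ≤
      ∫⁻ θ in Set.Ioo (-π) π, ‖h (z + ρ * (Real.cos θ + Real.sin θ * Complex.I))‖ₑ := by
  have hsub : closedBall z |ρ| ⊆ ball z r := by
    rw [abs_of_pos hρ]; exact closedBall_subset_ball hr
  have h1 : circleAverage h z ρ = h z :=
    circleAverage_of_differentiable_on_off_countable (s := ∅) Set.countable_empty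
      (hd.continuousOn.mono hsub)
      (fun w hw => hd.differentiableAt (isOpen_ball.mem_nhds (hsub (ball_subset_closedBall hw.1))))
  rw [circleAverage_eq_integral_add (-π)] at h1
  have h2 : ∫ θ in (-π)..π, h (z + ρ * (Real.cos θ + Real.sin θ * Complex.I)) = (2*π) • h z := by
    rw [← h1, smul_smul, mul_inv_cancel₀ (by positivity), one_smul,
      intervalIntegral.integral_comp_add_right (fun θ => h (circleMap z ρ θ))]
    have : (2*π + -π) = π := by ring
    rw [zero_add, this]
    congr 1
    ext θ
    simp [circleMap, Complex.exp_mul_I]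
  rw [intervalIntegral.integral_of_le (by linarith [pi_pos]), integral_Ioc_eq_integral_Ioo] at h2
  calc ENNReal.ofReal (2*π) * ‖h z‖ₑ = ‖(2*π) • h z‖ₑ := by
        rw [enorm_smul, Real.enorm_of_nonneg (by positivity)]
    _ ≤ _ := by rw [← h2]; exact enorm_integral_le_lintegral_enorm _

lemma area_lower (h : ℂ → ℂ) (z : ℂ) (r : ℝ) (hr : 0 < r)
    (hd : DifferentiableOn ℂ h (ball z r)) :
    ENNReal.ofReal (π * r^2) * ‖h z‖ₑ ≤ ∫⁻ w in ball z r, ‖h w‖ₑ := by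
  classical
  set H : ℂ → ℂ := (ball z r).indicator h with hH
  have hm : Measurable H := by
    rw [hH, ← Set.piecewise_eq_indicator]
    exact hd.continuousOn.measurable_piecewise continuousOn_const measurableSet_ball
  have e1 : ∫⁻ w in ball z r, ‖h w‖ₑ = ∫⁻ w, ‖H (z + w)‖ₑ := by
    rw [lintegral_add_left_eq_self (fun w => ‖H w‖ₑ) z, ← lintegral_indicator measurableSet_ball]
    congr 1; ext w
    simp only [hH, Set.indicator]; split_ifs <;> simp
  rw [e1, ← Complex.lintegral_comp_polarCoord_symm, polarCoord_target, Measure.volume_eq_prod,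
    ← Measure.prod_restrict, lintegral_prod]
  · have key : ∀ ρ ∈ Set.Ioo 0 r, ENNReal.ofReal ρ * (ENNReal.ofReal (2*π) * ‖h z‖ₑ) ≤
        ∫⁻ θ in Set.Ioo (-π) π, ENNReal.ofReal ρ • ‖H (z + Complex.polarCoord.symm (ρ, θ))‖ₑ := by
      intro ρ hρ
      simp only [smul_eq_mul]
      rw [lintegral_const_mul' _ _ ENNReal.ofReal_ne_top]
      gcongr
      refine (circle_lower h z r ρ hρ.1 hρ.2 hd).trans (le_of_eq ?_)
      congr 1; ext θ
      rw [Complex.polarCoord_symm_apply, hH, Set.indicator_of_mem]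
      rw [mem_ball, dist_eq_norm, add_sub_cancel_left, ← Complex.polarCoord_symm_apply (ρ, θ),
        Complex.norm_polarCoord_symm]
      simpa [abs_of_pos hρ.1] using hρ.2
    calc _ = ∫⁻ ρ in Set.Ioo 0 r, ENNReal.ofReal ρ * (ENNReal.ofReal (2*π) * ‖h z‖ₑ) := by
          rw [lintegral_mul_const _ (by fun_prop), ← ofReal_integral_eq_lintegral_ofReal]
          · rw [← integral_Ioc_eq_integral_Ioo, ← intervalIntegral.integral_of_le hr.le,
              integral_id, ← mul_assoc,
              ← ENNReal.ofReal_mul (by simp; positivity)]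
            congr 2; ring
          · exact (continuous_id.integrableOn_Icc (a := 0) (b := r)).mono_set Set.Ioo_subset_Icc_self
          · exact (ae_restrict_mem measurableSet_Ioo).mono fun x hx => hx.1.le
      _ ≤ ∫⁻ ρ in Set.Ioo 0 r, ∫⁻ θ in Set.Ioo (-π) π,
            ENNReal.ofReal ρ • ‖H (z + Complex.polarCoord.symm (ρ, θ))‖ₑ :=
          setLIntegral_mono' measurableSet_Ioo key
      _ ≤ _ := lintegral_mono_set Set.Ioo_subset_Ioi_self
  · simp only [Complex.polarCoord_symm_apply, smul_eq_mul]
    apply Measurable.aemeasurable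
    have : Measurable (fun p : ℝ × ℝ => z + p.1 * (Real.cos p.2 + Real.sin p.2 * Complex.I)) := by
      fun_prop
    exact (ENNReal.measurable_ofReal.comp measurable_fst).mul (hm.comp this).enorm

open Filter Topology InnerProductSpace in
lemma tendsto_radial_complex (g : ℂ → ℝ) (R : ℝ) (hR : 0 < R)
    (hh : ∀ z ∈ ball (0:ℂ) R \ {0}, HarmonicAt g z)
    (h1 : IntegrableOn (fun z => fderiv ℝ g z 1) (ball 0 R))
    (h2 : IntegrableOn (fun z => fderiv ℝ g z Complex.I) (ball 0 R)) :
    ∃ c : ℝ, Tendsto (fun z => fderiv ℝ g z z) (𝓝[≠] 0) (𝓝 c) := by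
  set h : ℂ → ℂ := fun z ↦ fderiv ℝ g z 1 - Complex.I * fderiv ℝ g z Complex.I with hdef
  have hd : ∀ z ∈ ball (0:ℂ) R \ {0}, DifferentiableAt ℂ h z :=
    fun z hz => HarmonicAt.differentiableAt_complex_partial (hh z hz)
  have hintg : IntegrableOn h (ball 0 R) :=
    h1.ofReal.sub (h2.ofReal.const_mul Complex.I)
  have hpn : ball (0:ℂ) R \ {0} ∈ 𝓝[≠] (0:ℂ) :=
    sdiff_mem_nhdsWithin_compl (ball_mem_nhds 0 hR) {0}
  have hlim : Tendsto (fun z : ℂ => ∫⁻ w in ball (0:ℂ) (2*‖z‖), ‖h w‖ₑ ∂(volume.restrict (ball 0 R)))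
      (𝓝[≠] 0) (𝓝 0) := by
    refine tendsto_setLIntegral_zero hintg.2.ne ?_
    have hv : Tendsto (fun z : ℂ => volume (ball (0:ℂ) (2*‖z‖))) (𝓝[≠] 0) (𝓝 0) := by
      simp only [Complex.volume_ball]
      have : Continuous (fun z : ℂ => ENNReal.ofReal (2*‖z‖) ^ 2 * (NNReal.pi : ENNReal)) := by
        refine ENNReal.continuous_mul_const ENNReal.coe_ne_top |>.comp ?_
        exact (ENNReal.continuous_pow 2).comp (ENNReal.continuous_ofReal.comp (by fun_prop))
      have := (this.tendsto 0).mono_left (nhdsWithin_le_nhds (s := {0}ᶜ))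
      simpa using this
    exact tendsto_of_tendsto_of_tendsto_of_le_of_le tendsto_const_nhds hv (fun _ => zero_le)
      (fun z => Measure.restrict_apply_le _ _)
  have ho : (fun z => z * h z - 0 * h 0) =o[𝓝[≠] (0:ℂ)] fun z => (z - 0)⁻¹ := by
    rw [Asymptotics.isLittleO_iff]
    intro ε hε
    have hsm : ∀ᶠ z : ℂ in 𝓝[≠] 0, z ∈ ball (0:ℂ) (R/2) \ {0} :=
      sdiff_mem_nhdsWithin_compl (ball_mem_nhds 0 (by positivity)) {0}
    filter_upwards [hsm, hlim.eventually (gt_mem_nhds (show (0:ENNReal) < ENNReal.ofReal (π/4*ε) by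
      simp; positivity))] with z hz hz2
    have hz0 : z ≠ 0 := hz.2
    have hzn : 0 < ‖z‖ := norm_pos_iff.2 hz0
    have hzR : ‖z‖ < R/2 := by simpa using hz.1
    have hsub1 : ball z (‖z‖/2) ⊆ ball (0:ℂ) R \ {0} := by
      intro w hw
      rw [mem_ball, dist_eq_norm] at hw
      refine ⟨?_, ?_⟩
      · rw [mem_ball_zero_iff]
        have := norm_add_le (w - z) z
        rw [sub_add_cancel] at this; linarith
      · rintro rfl
        rw [zero_sub, norm_neg] at hw; linarith
    have hsub2 : ball z (‖z‖/2) ⊆ ball (0:ℂ) (2*‖z‖) ∩ ball 0 R := by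
      intro w hw
      refine ⟨?_, (hsub1 hw).1⟩
      rw [mem_ball, dist_eq_norm] at hw
      rw [mem_ball_zero_iff]
      have := norm_add_le (w - z) z
      rw [sub_add_cancel] at this; linarith
    have ha := area_lower h z (‖z‖/2) (by positivity)
      (fun w hw => (hd w (hsub1 hw)).differentiableWithinAt)
    have hb : ∫⁻ w in ball z (‖z‖/2), ‖h w‖ₑ ≤
        ∫⁻ w in ball (0:ℂ) (2*‖z‖), ‖h w‖ₑ ∂(volume.restrict (ball 0 R)) := by
      rw [Measure.restrict_restrict measurableSet_ball]
      exact lintegral_mono_set hsub2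
    have hc := (ha.trans hb).trans hz2.le
    rw [← ofReal_norm, ← ENNReal.ofReal_mul (by positivity),
      ENNReal.ofReal_le_ofReal_iff (by positivity)] at hc
    have hfin : ‖z‖^2 * ‖h z‖ ≤ ε := by
      have : π/4 * (‖z‖^2 * ‖h z‖) ≤ π/4*ε := by nlinarith
      exact le_of_mul_le_mul_left this (by positivity)
    rw [zero_mul, sub_zero, sub_zero, norm_mul, norm_inv, ← div_eq_mul_inv, le_div_iff₀ hzn]
    nlinarith
  have hT := Complex.tendsto_limUnder_of_differentiable_on_punctured_nhds_of_isLittleO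
    (f := fun z => z * h z) (c := 0)
    (by filter_upwards [hpn] with z hz using differentiableAt_id.mul (hd z hz)) ho
  refine ⟨_, ((Complex.continuous_re.tendsto _).comp hT).congr fun z => ?_⟩
  have : fderiv ℝ g z z = z.re * fderiv ℝ g z 1 + z.im * fderiv ℝ g z Complex.I := by
    conv_lhs => rw [show fderiv ℝ g z z = fderiv ℝ g z (z.re • (1:ℂ) + z.im • Complex.I) by
      congr 1; simp [Complex.re_add_im]]
    rw [map_add, map_smul, map_smul, smul_eq_mul, smul_eq_mul]
  rw [this]
  simp [hdef]

abbrev E2 := EuclideanSpace ℝ (Fin 2)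

open Filter Topology InnerProductSpace in
lemma tendsto_radial (G : E2 → ℝ) (x : E2) (R : ℝ) (hR : 0 < R)
    (hG : ContDiffOn ℝ (⊤ : ℕ∞) G (ball x R \ {x}))
    (hh : ∀ y ∈ ball x R \ {x}, ∑ i : Fin 2, fderiv ℝ (fun z => fderiv ℝ G z (EuclideanSpace.single i 1)) y
      (EuclideanSpace.single i 1) = 0)
    (hi : ∀ i : Fin 2, IntegrableOn (fun z => fderiv ℝ G z (EuclideanSpace.single i 1)) (ball x R)) :
    ∃ c : ℝ, Tendsto (fun y => fderiv ℝ G y (y - x)) (𝓝[≠] x) (𝓝 c) := by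
  set e : ℂ ≃ₗᵢ[ℝ] E2 := Complex.orthonormalBasisOneI.repr with he
  have e1 : e 1 = EuclideanSpace.single 0 1 := by
    have := Complex.orthonormalBasisOneI.repr_self 0
    simpa using this
  have eI : e Complex.I = EuclideanSpace.single 1 1 := by
    have := Complex.orthonormalBasisOneI.repr_self 1
    simpa using this
  set T : ℂ → E2 := fun w => x + e w with hT
  have hTd : ∀ w, HasFDerivAt T (e.toContinuousLinearEquiv : ℂ →L[ℝ] E2) w := fun w =>
    (e.toContinuousLinearEquiv.hasFDerivAt).const_add x
  have hTmem : ∀ w, w ∈ ball (0:ℂ) R \ {0} ↔ T w ∈ ball x R \ {x} := by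
    intro w; simp [hT, dist_eq_norm]
  have hTpre : T ⁻¹' (ball x R) = ball 0 R := by ext w; simp [hT, dist_eq_norm]
  have hopE : IsOpen (ball x R \ {x}) := isOpen_ball.sdiff isClosed_singleton
  have hopC : IsOpen (ball (0:ℂ) R \ {0}) := isOpen_ball.sdiff isClosed_singleton
  have hGat : ∀ y ∈ ball x R \ {x}, ContDiffAt ℝ (⊤ : ℕ∞) G y :=
    fun y hy => hG.contDiffAt (hopE.mem_nhds hy)
  have comp_fd : ∀ (F : E2 → ℝ) (w v : ℂ), DifferentiableAt ℝ F (T w) →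
      fderiv ℝ (fun w => F (T w)) w v = fderiv ℝ F (T w) (e v) := by
    intro F w v hF
    have := (hF.hasFDerivAt.comp w (hTd w)).fderiv
    rw [show (fun w => F (T w)) = F ∘ T from rfl, this]; rfl
  set g : ℂ → ℝ := fun w => G (T w) with hg
  have hgd : ∀ w ∈ ball (0:ℂ) R \ {0}, ∀ v, fderiv ℝ g w v = fderiv ℝ G (T w) (e v) :=
    fun w hw v => comp_fd G w v ((hGat _ ((hTmem w).1 hw)).differentiableAt (by simp))
  have hTsm : ContDiff ℝ (⊤ : ℕ∞) T := contDiff_const.add e.contDiff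
  have hgsm : ∀ w ∈ ball (0:ℂ) R \ {0}, ContDiffAt ℝ (⊤ : ℕ∞) g w := fun w hw =>
    (hGat _ ((hTmem w).1 hw)).comp w hTsm.contDiffAt
  have hsec : ∀ w ∈ ball (0:ℂ) R \ {0}, ∀ v, fderiv ℝ (fderiv ℝ g) w v v =
      fderiv ℝ (fun z => fderiv ℝ G z (e v)) (T w) (e v) := by
    intro w hw v
    have d1 : DifferentiableAt ℝ (fderiv ℝ g) w :=
      ((hgsm w hw).fderiv_right (m := 1) (by norm_cast)).differentiableAt (by simp)
    have d2 : DifferentiableAt ℝ (fderiv ℝ G) (T w) :=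
      ((hGat _ ((hTmem w).1 hw)).fderiv_right (m := 1) (by norm_cast)).differentiableAt (by simp)
    have : fderiv ℝ (fun z => fderiv ℝ g z v) w v = fderiv ℝ (fderiv ℝ g) w v v := by
      rw [fderiv_clm_apply d1 (by fun_prop)]; simp
    rw [← this, ← comp_fd _ w v (by fun_prop)]
    congr 1
    apply Filter.EventuallyEq.fderiv_eq
    filter_upwards [hopC.mem_nhds hw] with z hz using hgd z hz v
  have hharm : ∀ w ∈ ball (0:ℂ) R \ {0}, HarmonicAt g w := by
    intro w hw
    refine ⟨(hgsm w hw).of_le (by norm_cast), ?_⟩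
    filter_upwards [hopC.mem_nhds hw] with z hz
    rw [laplacian_eq_iteratedFDeriv_complexPlane]
    simp only [iteratedFDeriv_two_apply]
    have := hh _ ((hTmem z).1 hz)
    rw [Fin.sum_univ_two] at this
    simp [hsec z hz, e1, eI, this]
  have hmp : MeasurePreserving T := (measurePreserving_add_left volume x).comp e.measurePreserving
  have hemb : MeasurableEmbedding T :=
    (e.toHomeomorph.trans (Homeomorph.addLeft x)).measurableEmbedding
  have hae : ∀ᵐ w ∂(volume.restrict (ball (0:ℂ) R)), w ∈ ball (0:ℂ) R \ {0} := by
    have : ∀ᵐ w ∂(volume.restrict (ball (0:ℂ) R)), w ≠ 0 := Measure.ae_ne _ _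
    filter_upwards [this, ae_restrict_mem measurableSet_ball] with w h1 h2 using ⟨h2, h1⟩
  have hI : ∀ (v : ℂ) (i : Fin 2), e v = EuclideanSpace.single i 1 →
      IntegrableOn (fun z => fderiv ℝ g z v) (ball 0 R) := by
    intro v i hv
    have := (hmp.integrableOn_comp_preimage hemb).2 (hi i)
    rw [hTpre] at this
    refine this.congr ?_
    filter_upwards [hae] with w hw
    rw [hgd w hw, hv]; rfl
  obtain ⟨c, hc⟩ := tendsto_radial_complex g R hR hharm (hI 1 0 e1) (hI Complex.I 1 eI)
  refine ⟨c, ?_⟩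
  have hS : Tendsto (fun y : E2 => e.symm (y - x)) (𝓝[≠] x) (𝓝[≠] 0) := by
    apply tendsto_nhdsWithin_of_tendsto_nhds_of_eventually_within
    · have : Continuous (fun y : E2 => e.symm (y - x)) := by fun_prop
      have := (this.tendsto x).mono_left (nhdsWithin_le_nhds (s := {x}ᶜ))
      simpa using this
    · filter_upwards [self_mem_nhdsWithin] with y hy
      simpa [sub_eq_zero] using hy
  refine (hc.comp hS).congr' ?_
  have hpn : ball x R \ {x} ∈ 𝓝[≠] x :=
    sdiff_mem_nhdsWithin_compl (ball_mem_nhds x hR) {x}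
  filter_upwards [hpn] with y hy
  have hTy : T (e.symm (y - x)) = y := by simp [hT]
  simp only [Function.comp]
  rw [hgd _ ((hTmem _).2 (by rwa [hTy])), hTy]
  simp

lemma inner_grad_left (G : E2 → ℝ) (y v : E2) : ⟪gradient G y, v⟫ = fderiv ℝ G y v := by
  simp [gradient]

lemma inner_grad_right (G : E2 → ℝ) (y v : E2) : ⟪v, gradient G y⟫ = fderiv ℝ G y v := by
  rw [real_inner_comm, inner_grad_left]

lemma grad_apply (G : E2 → ℝ) (y : E2) (i : Fin 2) :
    (gradient G y) i = fderiv ℝ G y (EuclideanSpace.single i 1) := by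
  rw [← inner_grad_left, EuclideanSpace.inner_single_right]; simp

open Filter Topology in
lemma partial_integrable {Ω : Set E2} {x : E2} {G : E2 → ℝ} (hG : IsGreensFunction Ω x G)
    (R : ℝ) (hR : 0 < R) (hsub : closedBall x (2*R) ⊆ Ω) (i : Fin 2) :
    IntegrableOn (fun z => fderiv ℝ G z (EuclideanSpace.single i 1)) (ball x R) := by
  obtain ⟨-, -, -, -, -, hw⟩ := hG
  let b : ContDiffBump x := ⟨R, 2*R, hR, by linarith⟩
  set f : E2 → ℝ := fun y => b y * (1 + (y i - x i)) with hf
  have hfx : f x = 1 := by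
    have : b x = 1 := b.one_of_mem_closedBall (mem_closedBall_self hR.le)
    simp [hf, this]
  have hfs : ContDiff ℝ (⊤ : ℕ∞) f := by
    refine b.contDiff.mul ?_
    fun_prop
  have hfc : HasCompactSupport f := b.hasCompactSupport.mul_right
  have hft : tsupport f ⊆ Ω := by
    refine (tsupport_mul_subset_left).trans ?_
    rw [b.tsupport_eq]; exact hsub
  have h := hw f hfs hfc hft
  rw [hfx] at h
  have hI : IntegrableOn (fun y => ⟪gradient G y, gradient f y⟫) Ω := by
    by_contra hcon
    rw [integral_undef hcon] at h
    exact zero_ne_one h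
  have hI2 : IntegrableOn (fun y => ⟪gradient G y, gradient f y⟫) (ball x R) :=
    hI.mono_set ((ball_subset_closedBall.trans (closedBall_subset_closedBall (by linarith))).trans hsub)
  refine hI2.congr_fun (fun y hy => ?_) measurableSet_ball
  simp only
  rw [inner_grad_right, ← grad_apply]
  have hev : f =ᶠ[𝓝 y] fun y => 1 + (y i - x i) := by
    filter_upwards [isOpen_ball.mem_nhds hy] with z hz
    have : b z = 1 := b.one_of_mem_closedBall (ball_subset_closedBall hz)
    simp [hf, this]
  rw [hev.fderiv_eq]
  have : HasFDerivAt (fun y : E2 => 1 + (y i - x i)) (EuclideanSpace.proj i : E2 →L[ℝ] ℝ) y :=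
    (((EuclideanSpace.proj i : E2 →L[ℝ] ℝ).hasFDerivAt).sub_const _).const_add _
  rw [this.fderiv]; rfl

lemma smoothTransition_deriv_bound : ∃ C : ℝ, 0 < C ∧ (∀ s, deriv smoothTransition s ≤ C) ∧
    (∀ s, s < 0 → deriv smoothTransition s = 0) := by
  have hc : Continuous (deriv smoothTransition) :=
    (smoothTransition.contDiff (n := 1)).continuous_deriv le_rfl
  obtain ⟨C, hC⟩ := isCompact_Icc.exists_bound_of_continuousOn (hc.continuousOn (s := Set.Icc 0 1))
  have h0 : ∀ s, s < 0 → deriv smoothTransition s = 0 := by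
    intro s hs
    have : smoothTransition =ᶠ[nhds s] fun _ => 0 := by
      filter_upwards [gt_mem_nhds hs] with u hu using smoothTransition.zero_of_nonpos (le_of_lt hu)
    rw [this.deriv_eq]; simp
  have h1 : ∀ s, 1 < s → deriv smoothTransition s = 0 := by
    intro s hs
    have : smoothTransition =ᶠ[nhds s] fun _ => 1 := by
      filter_upwards [lt_mem_nhds hs] with u hu using smoothTransition.one_of_one_le (le_of_lt hu)
    rw [this.deriv_eq]; simp
  refine ⟨max C 1, by positivity, fun s => ?_, h0⟩
  rcases lt_or_ge s 0 with hs | hs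
  · rw [h0 s hs]; positivity
  rcases lt_or_ge 1 s with hs1 | hs1
  · rw [h1 s hs1]; positivity
  exact ((le_abs_self _).trans (hC s ⟨hs, hs1⟩)).trans (le_max_left _ _)

open Filter Topology in
lemma radial_neg {Ω : Set E2} (hopen : IsOpen Ω) {x : E2} (hx : x ∈ Ω) {G : E2 → ℝ}
    (hG : IsGreensFunction Ω x G) (c : ℝ)
    (hc : Tendsto (fun y => fderiv ℝ G y (y - x)) (𝓝[≠] x) (𝓝 c)) : c < 0 := by
  obtain ⟨-, -, -, -, -, hw⟩ := hG
  by_contra! hc0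
  obtain ⟨C, hC0, hC, hCz⟩ := smoothTransition_deriv_bound
  set ε : ℝ := 1 / (16 * π * C) with hε
  have hεp : 0 < ε := by positivity
  have hev : ∀ᶠ y in 𝓝[≠] x, -ε < fderiv ℝ G y (y - x) :=
    hc.eventually (lt_mem_nhds (by linarith))
  rw [eventually_nhdsWithin_iff] at hev
  obtain ⟨r, hr, hball⟩ := Metric.mem_nhds_iff.1 (Filter.inter_mem hev (hopen.mem_nhds hx))
  set δ := r / 2 with hδ
  have hδp : 0 < δ := by positivity
  have h2δ : 2 * δ = r := by rw [hδ]; ring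
  set S := smoothTransition with hS
  set q : E2 → ℝ := fun y => 2 - ‖y - x‖^2 / δ^2 with hq
  set f : E2 → ℝ := fun y => S (q y) with hf
  have hqs : ContDiff ℝ (⊤ : ℕ∞) q := by
    have : ContDiff ℝ (⊤ : ℕ∞) (fun y : E2 => ‖y - x‖^2) :=
      (contDiff_id.sub contDiff_const).norm_sq ℝ
    exact contDiff_const.sub (this.div_const _)
  have hfs : ContDiff ℝ (⊤ : ℕ∞) f := smoothTransition.contDiff.comp hqs
  have hqneg : ∀ y, y ∉ closedBall x (3/2*δ) → q y < 0 := by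
    intro y hy
    rw [mem_closedBall, dist_eq_norm, not_le] at hy
    have : 2 < ‖y - x‖^2 / δ^2 := by
      rw [lt_div_iff₀ (by positivity)]; nlinarith
    simp only [hq]; linarith
  have hts : tsupport f ⊆ closedBall x (3/2*δ) := by
    refine closure_minimal ?_ isClosed_closedBall
    intro y hy
    by_contra hcon
    exact hy (smoothTransition.zero_of_nonpos (hqneg y hcon).le)
  have hcb : closedBall x (3/2*δ) ⊆ ball x r := closedBall_subset_ball (by linarith)
  have hfx : f x = 1 := by
    apply smoothTransition.one_of_one_le; simp [hq]
  have h := hw f hfs (HasCompactSupport.of_support_subset_isCompact (isCompact_closedBall x (3/2*δ))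
    ((subset_tsupport f).trans hts))
    ((hts.trans hcb).trans fun y hy => (hball hy).2)
  rw [hfx] at h
  have hI : IntegrableOn (fun y => ⟪gradient G y, gradient f y⟫) Ω := by
    by_contra hcon
    rw [integral_undef hcon] at h
    exact zero_ne_one h
  have hval : ∀ y, ⟪gradient G y, gradient f y⟫ =
      -(2/δ^2) * deriv S (q y) * fderiv ℝ G y (y - x) := by
    intro y
    have hq' : HasFDerivAt q (-((δ^2)⁻¹ • (2 • (innerSL ℝ (y - x))))) y := by
      have h1 : HasFDerivAt (fun y : E2 => ‖y - x‖^2) (2 • (innerSL ℝ (y - x))) y := by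
        have := ((hasFDerivAt_id (𝕜 := ℝ) y).sub_const x).norm_sq
        simpa using this
      have h2 := (h1.const_smul ((δ^2)⁻¹)).const_sub 2
      refine h2.congr_of_eventuallyEq (Eventually.of_forall fun z => ?_)
      simp [hq, div_eq_inv_mul]
    have hSd : HasDerivAt S (deriv S (q y)) (q y) :=
      ((smoothTransition.contDiff (n := 1)).differentiable (by simp) _).hasDerivAt
    have hf' := (hSd.comp_hasFDerivAt y hq').fderiv
    rw [inner_grad_right, show f = S ∘ q from rfl, hf']
    simp only [_root_.smul_apply, _root_.neg_apply, smul_eq_mul,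
      innerSL_apply_apply, inner_grad_right, nsmul_eq_mul]
    push_cast
    field_simp
  have hle : (1:ℝ) ≤ ∫ y in Ω, (ball x r).indicator (fun _ => 2/δ^2*C*ε) y := by
    rw [← h]
    refine integral_mono_ae hI ?_ ?_
    · exact (integrable_indicator_iff measurableSet_ball).2 (by
        refine integrableOn_const ?_ enorm_ne_top
        exact ((Measure.restrict_apply_le _ _).trans_lt measure_ball_lt_top).ne)
    · have hne : ∀ᵐ y ∂(volume.restrict Ω), y ≠ x := Measure.ae_ne _ _
      filter_upwards [hne] with y hy
      simp only [hval]
      by_cases hyr : y ∈ ball x r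
      · rw [Set.indicator_of_mem hyr]
        have h1 := (hball hyr).1 hy
        have h2 : 0 ≤ deriv S (q y) := smoothTransition.monotone.deriv_nonneg
        have h3 := hC (q y)
        have h4 : deriv S (q y) * (-fderiv ℝ G y (y - x)) ≤ C * ε := by
          calc _ ≤ deriv S (q y) * ε := by gcongr; linarith
            _ ≤ C * ε := by gcongr
        calc _ = 2/δ^2 * (deriv S (q y) * (-fderiv ℝ G y (y - x))) := by ring
          _ ≤ 2/δ^2 * (C * ε) := by gcongr
          _ = _ := by ring
      · rw [Set.indicator_of_notMem hyr, hCz _ (hqneg y fun h => hyr (hcb h))]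
        simp
  rw [setIntegral_indicator measurableSet_ball,
    Set.inter_eq_self_of_subset_right (fun y hy => (hball hy).2), setIntegral_const,
    measureReal_def, EuclideanSpace.volume_ball_fin_two, ENNReal.toReal_mul, ENNReal.toReal_pow,
    ENNReal.toReal_ofReal hr.le, ENNReal.toReal_ofReal pi_pos.le, ← h2δ, hε, smul_eq_mul] at hle
  have : (2 * δ) ^ 2 * π * (2 / δ ^ 2 * C * (1 / (16 * π * C))) = 1/2 := by
    field_simp; norm_num
  linarith

open Filter Topology in
lemma tendsto_top {Ω : Set E2} (hopen : IsOpen Ω) {x : E2} (hx : x ∈ Ω) {G : E2 → ℝ}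
    (hG : IsGreensFunction Ω x G) (c : ℝ) (hc0 : c < 0)
    (hc : Tendsto (fun y => fderiv ℝ G y (y - x)) (𝓝[≠] x) (𝓝 c)) :
    Tendsto G (𝓝[≠] x) atTop := by
  obtain ⟨hpos, -, -, hsm, -, -⟩ := hG
  have hev : ∀ᶠ y in 𝓝[≠] x, fderiv ℝ G y (y - x) < c/2 :=
    hc.eventually (gt_mem_nhds (by linarith))
  rw [eventually_nhdsWithin_iff] at hev
  obtain ⟨r, hr, hball⟩ := Metric.mem_nhds_iff.1 (Filter.inter_mem hev (hopen.mem_nhds hx))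
  have hopE : IsOpen (Ω \ {x}) := hopen.sdiff isClosed_singleton
  have key : ∀ y ∈ ball x (r/2) \ {x}, -(c/2) * log ((r/2) / ‖y - x‖) ≤ G y := by
    intro y hy
    have hyx : y - x ≠ 0 := sub_ne_zero.2 hy.2
    have hn : 0 < ‖y - x‖ := norm_pos_iff.2 hyx
    have hlt : ‖y - x‖ < r/2 := by simpa [dist_eq_norm] using hy.1
    set s1 := (r/2) / ‖y - x‖ with hs1
    have h1s : 1 ≤ s1 := by rw [hs1, le_div_iff₀ hn]; linarith
    have hmem : ∀ s ∈ Set.Icc 1 s1, x + s • (y - x) ∈ ball x r ∧ x + s • (y - x) ≠ x := by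
      intro s hs
      have hs0 : 0 < s := by linarith [hs.1]
      constructor
      · rw [mem_ball, dist_eq_norm, add_sub_cancel_left, norm_smul, norm_of_nonneg hs0.le]
        have := hs.2
        rw [hs1, le_div_iff₀ hn] at this
        linarith
      · simp [hs0.ne', hyx]
    have hder : ∀ s ∈ Set.Icc 1 s1, HasDerivAt (fun s : ℝ => G (x + s • (y - x)) - (c/2) * log s)
        (fderiv ℝ G (x + s • (y - x)) (y - x) - (c/2) * s⁻¹) s := by
      intro s hs
      have hs0 : 0 < s := by linarith [hs.1]
      obtain ⟨m1, m2⟩ := hmem s hs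
      have hd : DifferentiableAt ℝ G (x + s • (y - x)) :=
        (hsm.contDiffAt (hopE.mem_nhds ⟨(hball m1).2, m2⟩)).differentiableAt (by simp)
      have hline : HasDerivAt (fun s : ℝ => x + s • (y - x)) (y - x) s := by
        simpa using ((hasDerivAt_id s).smul_const (y - x)).const_add x
      exact (hd.hasFDerivAt.comp_hasDerivAt s hline).sub ((hasDerivAt_log hs0.ne').const_mul _)
    have hanti : AntitoneOn (fun s : ℝ => G (x + s • (y - x)) - (c/2) * log s) (Set.Icc 1 s1) := by
      refine antitoneOn_of_deriv_nonpos (convex_Icc _ _)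
        (fun s hs => (hder s hs).continuousAt.continuousWithinAt)
        (fun s hs => (hder s (interior_subset hs)).differentiableAt.differentiableWithinAt) ?_
      intro s hs
      have hs' := interior_subset hs
      have hs0 : 0 < s := by linarith [hs'.1]
      obtain ⟨m1, m2⟩ := hmem s hs'
      rw [(hder s hs').deriv]
      have := (hball m1).1 m2
      simp only [add_sub_cancel_left, map_smul, smul_eq_mul] at this
      have h3 : fderiv ℝ G (x + s • (y - x)) (y - x) < c/2 * s⁻¹ := by
        rw [← div_eq_mul_inv, lt_div_iff₀ hs0]; linarith
      linarith
    have := hanti (Set.left_mem_Icc.2 h1s) (Set.right_mem_Icc.2 h1s) h1s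
    simp only [log_one, one_smul, add_sub_cancel, mul_zero, sub_zero] at this
    obtain ⟨m1, m2⟩ := hmem s1 (Set.right_mem_Icc.2 h1s)
    have hp := hpos _ ⟨(hball m1).2, m2⟩
    linarith
  have hlog : Tendsto (fun y : E2 => -(c/2) * log ((r/2) / ‖y - x‖)) (𝓝[≠] x) atTop := by
    refine Tendsto.const_mul_atTop (by linarith) (tendsto_log_atTop.comp ?_)
    simp only [div_eq_mul_inv]
    refine Tendsto.const_mul_atTop (by positivity) (tendsto_inv_nhdsGT_zero.comp ?_)
    apply tendsto_nhdsWithin_of_tendsto_nhds_of_eventually_within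
    · have : Continuous (fun y : E2 => ‖y - x‖) := by fun_prop
      have := (this.tendsto x).mono_left (nhdsWithin_le_nhds (s := {x}ᶜ))
      simpa using this
    · filter_upwards [self_mem_nhdsWithin] with y hy
      simpa [sub_eq_zero] using hy
  refine tendsto_atTop_mono' _ ?_ hlog
  have hpn : ball x (r/2) \ {x} ∈ 𝓝[≠] x :=
    sdiff_mem_nhdsWithin_compl (ball_mem_nhds x (by positivity)) {x}
  filter_upwards [hpn] with y hy using key y hy

open Filter Topology in
lemma pushforward {Ω : Set E2} (hopen : IsOpen Ω) (hbdd : Bornology.IsBounded Ω)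
    {x : E2} (hx : x ∈ Ω) {G : E2 → ℝ}
    (hG : IsGreensFunction Ω x G) (htop : Tendsto G (𝓝[≠] x) atTop)
    (ψ : ℝ → ℝ) (hψ : ContDiff ℝ (⊤ : ℕ∞) ψ) (a b : ℝ) (ha : 0 < a) (hab : a ≤ b)
    (h1 : ∀ s, s ≤ a → ψ s = 0) (h2 : ∀ s, b ≤ s → ψ s = 0) :
    ∫ y in Ω, ψ (G y) * ‖gradient G y‖^2 = ∫ s in (0:ℝ)..b, ψ s := by
  classical
  obtain ⟨hpos, hcont, hbd, hsm, -, hw⟩ := hG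
  set φ : ℝ → ℝ := fun s => ∫ u in (0:ℝ)..s, ψ u with hφ
  have hφd : ∀ s, HasDerivAt φ (ψ s) s := fun s => hψ.continuous.integral_hasStrictDerivAt 0 s |>.hasDerivAt
  have hφs : ContDiff ℝ (⊤ : ℕ∞) φ := by
    rw [contDiff_infty_iff_deriv]
    refine ⟨fun s => (hφd s).differentiableAt, ?_⟩
    rwa [show deriv φ = ψ from funext fun s => (hφd s).deriv]
  have hintg : ∀ u v, IntervalIntegrable ψ volume u v := fun u v =>
    hψ.continuous.intervalIntegrable u v
  have hφ0 : ∀ s, 0 ≤ s → s ≤ a → φ s = 0 := by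
    intro s h0 hs
    simp only [hφ]
    rw [intervalIntegral.integral_congr (g := fun _ => 0), intervalIntegral.integral_zero]
    intro u hu
    rw [Set.uIcc_of_le h0] at hu
    exact h1 u (hu.2.trans hs)
  have hφb : ∀ s, b ≤ s → φ s = φ b := by
    intro s hs
    simp only [hφ]
    rw [← intervalIntegral.integral_add_adjacent_intervals (hintg 0 b) (hintg b s),
      intervalIntegral.integral_congr (g := fun _ => 0) (a := b), intervalIntegral.integral_zero,
      add_zero]
    intro u hu
    rw [Set.uIcc_of_le hs] at hu
    exact h2 u hu.1
  set f : E2 → ℝ := fun y => if y = x then φ b else if y ∈ Ω then φ (G y) else 0 with hf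
  have hopE : IsOpen (Ω \ {x}) := hopen.sdiff isClosed_singleton
  have hfΩ : ∀ y ∈ Ω \ {x}, f =ᶠ[𝓝 y] fun z => φ (G z) := by
    intro y hy
    filter_upwards [hopE.mem_nhds hy] with z hz
    have : z ≠ x := hz.2
    simp [hf, this, hz.1]
  have hfx : f =ᶠ[𝓝 x] fun _ => φ b := by
    have := htop.eventually_ge_atTop b
    rw [eventually_nhdsWithin_iff] at this
    filter_upwards [this, hopen.mem_nhds hx] with z hz hzΩ
    by_cases hzx : z = x
    · simp [hf, hzx]
    · simp [hf, hzx, hzΩ, hφb _ (hz hzx)]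
  have hfout : ∀ y, y ∉ Ω → f =ᶠ[𝓝 y] fun _ => 0 := by
    intro y hy
    have hyx : y ≠ x := fun h => hy (h ▸ hx)
    by_cases hyc : y ∈ closure Ω
    · have hfr : y ∈ frontier Ω := ⟨hyc, by rwa [hopen.interior_eq]⟩
      have hcy : ContinuousWithinAt G (closure Ω \ {x}) y := hcont y ⟨hyc, hyx⟩
      have hlt : ∀ᶠ z in 𝓝[closure Ω \ {x}] y, G z < a :=
        hcy.eventually (gt_mem_nhds (by rw [hbd y hfr]; exact ha))
      rw [eventually_nhdsWithin_iff] at hlt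
      filter_upwards [hlt, isOpen_ne.mem_nhds hyx] with z hz hzx
      have hzx' : z ≠ x := hzx
      by_cases hzΩ : z ∈ Ω
      · simp [hf, hzx', hzΩ, hφ0 _ (hpos z ⟨hzΩ, hzx⟩).le (hz ⟨subset_closure hzΩ, hzx⟩).le]
      · simp [hf, hzx', hzΩ]
    · filter_upwards [isClosed_closure.isOpen_compl.mem_nhds hyc, isOpen_ne.mem_nhds hyx] with z hz hzx
      have hzx' : z ≠ x := hzx
      have hzΩ : z ∉ Ω := fun h => hz (subset_closure h)
      simp [hf, hzx', hzΩ]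
  have hGat : ∀ y ∈ Ω \ {x}, ContDiffAt ℝ (⊤ : ℕ∞) G y :=
    fun y hy => hsm.contDiffAt (hopE.mem_nhds hy)
  have hfs : ContDiff ℝ (⊤ : ℕ∞) f := by
    rw [contDiff_iff_contDiffAt]
    intro y
    by_cases hyΩ : y ∈ Ω
    · by_cases hyx : y = x
      · subst hyx; exact contDiffAt_const.congr_of_eventuallyEq hfx
      · exact ((hφs.contDiffAt).comp y (hGat y ⟨hyΩ, hyx⟩)).congr_of_eventuallyEq (hfΩ y ⟨hyΩ, hyx⟩)
    · exact contDiffAt_const.congr_of_eventuallyEq (hfout y hyΩ)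
  have hts : tsupport f ⊆ Ω := by
    intro y hy
    by_contra hyΩ
    exact (notMem_tsupport_iff_eventuallyEq.2 (hfout y hyΩ)) hy
  have hcs : HasCompactSupport f :=
    Metric.isCompact_of_isClosed_isBounded (isClosed_tsupport f) (hbdd.subset hts)
  have h := hw f hfs hcs hts
  have hfxv : f x = φ b := by simp [hf]
  rw [hfxv] at h
  rw [show ∫ s in (0:ℝ)..b, ψ s = φ b from rfl, ← h]
  refine integral_congr_ae ?_
  have hne : ∀ᵐ y ∂(volume.restrict Ω), y ≠ x := Measure.ae_ne _ _
  filter_upwards [hne, ae_restrict_mem hopen.measurableSet] with y hyx hyΩ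
  rw [inner_grad_right, (hfΩ y ⟨hyΩ, hyx⟩).fderiv_eq]
  have hd : HasFDerivAt G (fderiv ℝ G y) y :=
    ((hGat y ⟨hyΩ, hyx⟩).differentiableAt (by simp)).hasFDerivAt
  have := ((hφd (G y)).comp_hasFDerivAt y hd).fderiv
  rw [show (fun z => φ (G z)) = φ ∘ G from rfl, this]
  rw [_root_.smul_apply, smul_eq_mul, ← inner_grad_left, real_inner_self_eq_norm_sq]

open Filter Topology in
lemma energy_of_tendsto {Ω : Set E2} (hopen : IsOpen Ω) (hbdd : Bornology.IsBounded Ω)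
    {x : E2} (hx : x ∈ Ω) {G : E2 → ℝ}
    (hG : IsGreensFunction Ω x G) (htop : Tendsto G (𝓝[≠] x) atTop) (t : ℝ) (ht : 0 < t) :
    (∫ y in {y ∈ Ω | G y < t}, ‖gradient G y‖ ^ 2) = t := by
  have hopE : IsOpen (Ω \ {x}) := hopen.sdiff isClosed_singleton
  set δ : ℕ → ℝ := fun n => t / (4 * (n + 2)) with hδ
  have hδp : ∀ n, 0 < δ n := fun n => by positivity
  have hδlt : ∀ n, 8 * δ n ≤ t := fun n => by
    have : δ n * (4 * (n + 2)) = t := by simp only [hδ]; field_simp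
    have h2 : (0:ℝ) ≤ n := n.cast_nonneg
    nlinarith [hδp n]
  have hδ0 : Tendsto δ atTop (𝓝 0) := by
    refine Tendsto.div_atTop tendsto_const_nhds (Tendsto.const_mul_atTop (by norm_num) ?_)
    exact tendsto_atTop_add_const_right _ _ tendsto_natCast_atTop_atTop
  let ψ : ∀ n, ContDiffBump (t/2) := fun n =>
    ⟨t/2 - 2 * δ n, t/2 - δ n, by linarith [hδlt n, hδp n], by linarith [hδp n]⟩
  have hψz : ∀ n s, t/2 - δ n ≤ |s - t/2| → ψ n s = 0 := fun n s hs =>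
    (ψ n).zero_of_le_dist hs
  have hψ1 : ∀ n s, |s - t/2| ≤ t/2 - 2 * δ n → ψ n s = 1 := fun n s hs =>
    (ψ n).one_of_mem_closedBall hs
  set F : ℕ → E2 → ℝ := fun n y => ψ n (G y) * ‖gradient G y‖^2 with hF
  have hFnn : ∀ n y, 0 ≤ F n y := fun n y => mul_nonneg (ψ n).nonneg (sq_nonneg _)
  have hFint : ∀ n, ∫ y in Ω, F n y = ∫ s in (0:ℝ)..(t - δ n), ψ n s := fun n =>
    pushforward hopen hbdd hx hG htop (ψ n) (ψ n).contDiff (δ n) (t - δ n) (hδp n)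
      (by linarith [hδlt n, hδp n])
      (fun s hs => hψz n s (by rw [abs_of_nonpos] <;> linarith [hδlt n, hδp n]))
      (fun s hs => hψz n s (by rw [abs_of_nonneg] <;> linarith [hδlt n, hδp n]))
  have hii : ∀ n u v, IntervalIntegrable (ψ n) volume u v := fun n u v =>
    (ψ n).continuous.intervalIntegrable u v
  have hup : ∀ n, ∫ y in Ω, F n y ≤ t := by
    intro n
    rw [hFint]
    have := intervalIntegral.integral_mono_on (a := 0) (b := t - δ n) (by linarith [hδlt n, hδp n])
      (hii n _ _) (intervalIntegrable_const (c := (1:ℝ))) (fun s _ => (ψ n).le_one)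
    simp at this
    linarith [hδp n]
  have hlow : ∀ n, t - 4 * δ n ≤ ∫ y in Ω, F n y := by
    intro n
    rw [hFint]
    have h3 := hδlt n
    have h4 := hδp n
    have e1 : ∫ s in (2 * δ n)..(t - 2 * δ n), ψ n s = t - 4 * δ n := by
      rw [intervalIntegral.integral_congr (g := fun _ => 1)]
      · simp; ring
      · intro s hs
        rw [Set.uIcc_of_le (by linarith)] at hs
        exact hψ1 n s (abs_le.2 ⟨by linarith [hs.1], by linarith [hs.2]⟩)
    rw [← e1]
    exact intervalIntegral.integral_mono_interval (by linarith) (by linarith) (by linarith)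
      (Eventually.of_forall fun s => (ψ n).nonneg) (hii n _ _)
  have hFI : ∀ n, IntegrableOn (F n) Ω := by
    intro n
    by_contra hcon
    have := hlow n
    rw [integral_undef hcon] at this
    linarith [hδlt n, hδp n]
  have hne : ∀ᵐ y ∂(volume.restrict Ω), y ∈ Ω \ {x} := by
    have h1 : ∀ᵐ y ∂(volume.restrict Ω), y ≠ x := Measure.ae_ne _ _
    filter_upwards [h1, ae_restrict_mem hopen.measurableSet] with y hyx hyΩ using ⟨hyΩ, hyx⟩
  set D : E2 → ℝ := fun y => if G y < t then ‖gradient G y‖^2 else 0 with hD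
  have hDnn : ∀ y, 0 ≤ D y := fun y => by simp only [hD]; split_ifs <;> positivity
  -- pointwise convergence
  have hlim : ∀ y ∈ Ω \ {x}, Tendsto (fun n => F n y) atTop (𝓝 (D y)) := by
    intro y hy
    have hp := hG.1 y hy
    apply tendsto_const_nhds.congr'
    by_cases hlt : G y < t
    · have hm : 0 < min (G y) (t - G y) := lt_min hp (by linarith)
      have : ∀ᶠ n in atTop, 2 * δ n < min (G y) (t - G y) := by
        have := hδ0.const_mul 2
        rw [mul_zero] at this
        exact this.eventually (gt_mem_nhds hm)
      filter_upwards [this] with n hn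
      have ha := hn.trans_le (min_le_left _ _)
      have hb := hn.trans_le (min_le_right _ _)
      simp only [hF, hD, if_pos hlt]
      rw [hψ1 n _ (abs_le.2 ⟨by linarith, by linarith⟩), one_mul]
    · refine Eventually.of_forall fun n => ?_
      simp only [hF, hD, if_neg hlt]
      rw [hψz n, zero_mul]
      push Not at hlt
      rw [abs_of_nonneg] <;> linarith [hδp n]
  have hFle : ∀ n, ∀ y, F n y ≤ D y := by
    intro n y
    by_cases hlt : G y < t
    · simp only [hF, hD, if_pos hlt]
      exact mul_le_of_le_one_left (sq_nonneg _) (ψ n).le_one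
    · simp only [hF, hD, if_neg hlt]
      push Not at hlt
      rw [hψz n, zero_mul]
      rw [abs_of_nonneg] <;> linarith [hδp n]
  have hDm : AEStronglyMeasurable D (volume.restrict Ω) :=
    aestronglyMeasurable_of_tendsto_ae atTop (fun n => (hFI n).1)
      (by filter_upwards [hne] with y hy using hlim y hy)
  have hDl : ∫⁻ y in Ω, ENNReal.ofReal (D y) ≤ ENNReal.ofReal t := by
    calc ∫⁻ y in Ω, ENNReal.ofReal (D y)
        = ∫⁻ y in Ω, liminf (fun n => ENNReal.ofReal (F n y)) atTop := by
          refine lintegral_congr_ae ?_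
          filter_upwards [hne] with y hy
          exact ((ENNReal.continuous_ofReal.tendsto _).comp (hlim y hy)).liminf_eq.symm
      _ ≤ liminf (fun n => ∫⁻ y in Ω, ENNReal.ofReal (F n y)) atTop :=
          lintegral_liminf_le' fun n => (hFI n).1.aemeasurable.ennreal_ofReal
      _ ≤ liminf (fun _ : ℕ => ENNReal.ofReal t) atTop := by
          refine liminf_le_liminf (Eventually.of_forall fun n => ?_)
          rw [← ofReal_integral_eq_lintegral_ofReal (hFI n) (Eventually.of_forall (hFnn n))]
          exact ENNReal.ofReal_le_ofReal (hup n)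
      _ = _ := by simp
  have hDI : IntegrableOn D Ω := by
    refine ⟨hDm, ?_⟩
    rw [hasFiniteIntegral_iff_ofReal (Eventually.of_forall hDnn)]
    exact hDl.trans_lt ENNReal.ofReal_lt_top
  have hle : ∫ y in Ω, D y ≤ t := by
    rw [← ofReal_integral_eq_lintegral_ofReal hDI (Eventually.of_forall hDnn),
      ENNReal.ofReal_le_ofReal_iff ht.le] at hDl
    exact hDl
  have hge : t ≤ ∫ y in Ω, D y := by
    have hl : Tendsto (fun n => t - 4 * δ n) atTop (𝓝 t) := by
      have := (hδ0.const_mul 4).const_sub t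
      simpa using this
    exact le_of_tendsto' hl fun n => (hlow n).trans (integral_mono (hFI n) hDI (hFle n))
  have hval := le_antisymm hle hge
  -- rewrite the set integral
  have hset : MeasurableSet {y ∈ Ω \ {x} | G y < t} := by
    have : IsOpen ((Ω \ {x}) ∩ G ⁻¹' (Set.Iio t)) :=
      (hG.2.2.2.1.continuousOn).isOpen_inter_preimage hopE isOpen_Iio
    exact this.measurableSet
  have hae : ({y ∈ Ω | G y < t} : Set E2) =ᵐ[volume] {y ∈ Ω \ {x} | G y < t} := by
    have h1 : ∀ᵐ y ∂(volume : Measure E2), y ≠ x := Measure.ae_ne _ _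
    filter_upwards [h1] with y hy
    apply propext
    show (y ∈ Ω ∧ G y < t) ↔ ((y ∈ Ω ∧ y ∉ ({x} : Set E2)) ∧ G y < t)
    simp [hy]
  rw [setIntegral_congr_set hae]
  refine Eq.trans ?_ hval
  rw [← integral_indicator hset, ← integral_indicator hopen.measurableSet]
  refine integral_congr_ae ?_
  have h1 : ∀ᵐ y ∂(volume : Measure E2), y ≠ x := Measure.ae_ne _ _
  filter_upwards [h1] with y hy
  by_cases hyΩ : y ∈ Ω <;> by_cases hlt : G y < t <;> simp [Set.indicator, hD, hy, hyΩ, hlt]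

/-- Lemma 3.5, first identity: the Dirichlet energy of the Green's function on
the sublevel set `{G < t}` equals `t`. -/
theorem greens_function_sublevel_energy
    (Ω : Set (EuclideanSpace ℝ (Fin 2)))
    (hopen : IsOpen Ω) (hbdd : Bornology.IsBounded Ω)
    (hbry : HasSmoothBoundary Ω)
    (x : EuclideanSpace ℝ (Fin 2)) (hx : x ∈ Ω)
    (G : EuclideanSpace ℝ (Fin 2) → ℝ) (hG : IsGreensFunction Ω x G) :
    ∀ t : ℝ, 0 ≤ t →
      (∫ y in {y ∈ Ω | G y < t}, ‖gradient G y‖ ^ 2) = t := by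
  intro t ht
  rcases ht.eq_or_lt with rfl | ht
  · have : ({y ∈ Ω | G y < 0} : Set E2) ⊆ {x} := by
      intro y hy
      by_contra hyx
      exact (hG.1 y ⟨hy.1, hyx⟩).not_gt hy.2
    exact setIntegral_measure_zero _ (measure_mono_null this (measure_singleton x))
  obtain ⟨r, hr, hball⟩ := Metric.isOpen_iff.1 hopen x hx
  have hsub1 : ball x (r/3) ⊆ Ω := (ball_subset_ball (by linarith)).trans hball
  have hsub : ball x (r/3) \ {x} ⊆ Ω \ {x} := Set.sdiff_subset_sdiff_left hsub1
  obtain ⟨c, hc⟩ := tendsto_radial G x (r/3) (by positivity) (hG.2.2.2.1.mono hsub)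
    (fun y hy => hG.2.2.2.2.1 y (hsub hy))
    (partial_integrable hG (r/3) (by positivity)
      ((closedBall_subset_ball (by linarith)).trans hball))
  exact energy_of_tendsto hopen hbdd hx hG
    (tendsto_top hopen hx hG c (radial_neg hopen hx hG c hc) hc) t ht
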